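/- Let n ≥ 1, 0 < ν < 1, ρ > 0, k_> ≥ 0 and 0 ≤ k_< < n/2, and set k = max(k_<, k_>). Then the integral C² := ∫_{ℝⁿ} f̄(η)^{−2} (1 + 2^{2k} f₀(η)^{2ν}) dη is finite, and for all measurable v₁, v₂ : ℝⁿ → ℂ one has ‖f̄ · (|v₁| ∗ |v₂|)‖_{L²(ℝⁿ)} ≤ C · ‖f̄ v₁‖_{L²(ℝⁿ)} · ‖f̄ v₂‖_{L²(ℝⁿ)}. (Lemma B.1, stated in convolution form; via the Fourier transform it says that the space K with norm ‖u; K‖ = ‖f̄ û‖₂ is an algebra under pointwise multiplication, ‖u₁u₂; K‖ ≤ C‖u₁; K‖‖u₂; K‖.) -/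

import Mathlib

open MeasureTheory ENNReal

/-- The Gevrey weight `f₀(ξ) = exp(ρ |ξ|^ν)`. -/
noncomputable def f0gev {n : ℕ} (ν ρ : ℝ) (ξ : EuclideanSpace ℝ (Fin n)) : ℝ :=
  Real.exp (ρ * ‖ξ‖ ^ ν)

/-- The Gevrey weight `f(ξ) = exp(ρ · max(|ξ|^ν, 1))`. -/
noncomputable def fgev {n : ℕ} (ν ρ : ℝ) (ξ : EuclideanSpace ℝ (Fin n)) : ℝ :=
  Real.exp (ρ * max (‖ξ‖ ^ ν) 1)

/-- The weight `f₁(ξ) = |ξ|^{k_>}` for `|ξ| > 1` and `f₁(ξ) = |ξ|^{k_<}` for `|ξ| ≤ 1`. -/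
noncomputable def f1w {n : ℕ} (kgt klt : ℝ) (ξ : EuclideanSpace ℝ (Fin n)) : ℝ :=
  if 1 < ‖ξ‖ then ‖ξ‖ ^ kgt else ‖ξ‖ ^ klt

/-- The combined weight `f̄ = f · f₁`. -/
noncomputable def fbar {n : ℕ} (ν ρ kgt klt : ℝ) (ξ : EuclideanSpace ℝ (Fin n)) : ℝ :=
  fgev ν ρ ξ * f1w kgt klt ξ

/-- The convolution of the absolute values of `v₁` and `v₂`, valued in `[0, ∞]`. -/
noncomputable def convAbs {n : ℕ} (v₁ v₂ : EuclideanSpace ℝ (Fin n) → ℂ)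
    (ξ : EuclideanSpace ℝ (Fin n)) : ℝ≥0∞ :=
  ∫⁻ η, (‖v₁ (ξ - η)‖₊ : ℝ≥0∞) * (‖v₂ η‖₊ : ℝ≥0∞)

lemma rpow_le_add_of_le_add {ν a b c : ℝ} (hν0 : 0 < ν) (hν1 : ν < 1) (ha : 0 ≤ a) (hab : a ≤ b)
    (hc : 0 ≤ c) (hcab : c ≤ a + b) : c ^ ν ≤ b ^ ν + ν * a ^ ν := by
  rcases ha.eq_or_lt with rfl | ha
  · rw [Real.zero_rpow hν0.ne', mul_zero, add_zero]
    exact Real.rpow_le_rpow hc (by linarith) hν0.le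
  have hb : 0 < b := ha.trans_le hab
  have h1 : c ^ ν ≤ (b * (1 + a / b)) ^ ν := by
    refine Real.rpow_le_rpow hc (hcab.trans_eq ?_) hν0.le
    field_simp
    ring
  have h2 : (1 + a / b) ^ ν ≤ 1 + ν * (a / b) :=
    rpow_one_add_le_one_add_mul_self (by linarith [div_nonneg ha.le hb.le]) hν0.le hν1.le
  have h3 : a / b ≤ (a / b) ^ ν := by
    simpa using Real.rpow_le_rpow_of_exponent_ge (div_pos ha hb) ((div_le_one hb).2 hab) hν1.le
  rw [Real.mul_rpow hb.le (by positivity)] at h1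
  rw [Real.div_rpow ha.le hb.le] at h3
  have hbν : 0 < b ^ ν := by positivity
  calc c ^ ν ≤ b ^ ν * (1 + a / b) ^ ν := h1
    _ ≤ b ^ ν * (1 + ν * (a ^ ν / b ^ ν)) := by gcongr; exact h2.trans (by gcongr)
    _ = b ^ ν + ν * a ^ ν := by field_simp

section Weights

variable {n : ℕ} {ν ρ kgt klt : ℝ}

lemma f1w_nonneg (ξ : EuclideanSpace ℝ (Fin n)) : 0 ≤ f1w kgt klt ξ := by
  unfold f1w; split_ifs <;> positivity

lemma fgev_pos (ξ : EuclideanSpace ℝ (Fin n)) : 0 < fgev ν ρ ξ := Real.exp_pos _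

lemma fbar_nonneg (ξ : EuclideanSpace ℝ (Fin n)) : 0 ≤ fbar ν ρ kgt klt ξ :=
  mul_nonneg (fgev_pos ξ).le (f1w_nonneg ξ)

lemma fbar_pos {ξ : EuclideanSpace ℝ (Fin n)} (hξ : ξ ≠ 0) : 0 < fbar ν ρ kgt klt ξ := by
  have : 0 < ‖ξ‖ := norm_pos_iff.2 hξ
  refine mul_pos (fgev_pos ξ) ?_
  unfold f1w; split_ifs <;> positivity

lemma measurable_fbar : Measurable (fbar (n := n) ν ρ kgt klt) := by
  unfold fbar fgev f1w
  refine Measurable.mul (by fun_prop) (Measurable.ite ?_ (by fun_prop) (by fun_prop))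
  exact measurableSet_lt measurable_const measurable_norm

lemma f1w_mono (hkgt : 0 ≤ kgt) (hklt : 0 ≤ klt) {ξ η : EuclideanSpace ℝ (Fin n)}
    (h : ‖ξ‖ ≤ ‖η‖) : f1w kgt klt ξ ≤ f1w kgt klt η := by
  unfold f1w
  split_ifs with h1 h2 h2
  · gcongr
  · linarith
  · exact (Real.rpow_le_one (norm_nonneg _) (not_lt.1 h1) hklt).trans
      (Real.one_le_rpow h2.le hkgt)
  · gcongr

lemma fbar_mono (hν : 0 ≤ ν) (hρ : 0 ≤ ρ) (hkgt : 0 ≤ kgt) (hklt : 0 ≤ klt)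
    {ξ η : EuclideanSpace ℝ (Fin n)} (h : ‖ξ‖ ≤ ‖η‖) :
    fbar ν ρ kgt klt ξ ≤ fbar ν ρ kgt klt η := by
  refine mul_le_mul ?_ (f1w_mono hkgt hklt h) (f1w_nonneg _) (fgev_pos _).le
  unfold fgev
  gcongr

lemma f1w_le_two_rpow_mul (hkgt : 0 ≤ kgt) (hklt : 0 ≤ klt) {ξ η : EuclideanSpace ℝ (Fin n)}
    (h : ‖ξ‖ ≤ 2 * ‖η‖) : f1w kgt klt ξ ≤ 2 ^ max klt kgt * f1w kgt klt η := by
  have key : ∀ {s : ℝ}, 0 ≤ s → s ≤ max klt kgt → ‖ξ‖ ^ s ≤ 2 ^ max klt kgt * ‖η‖ ^ s := by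
    intro s hs hsk
    calc ‖ξ‖ ^ s ≤ (2 * ‖η‖) ^ s := by gcongr
      _ = 2 ^ s * ‖η‖ ^ s := Real.mul_rpow (by norm_num) (norm_nonneg _)
      _ ≤ _ := by gcongr; norm_num
  rcases le_total ‖ξ‖ ‖η‖ with h' | h'
  · exact (f1w_mono hkgt hklt h').trans (le_mul_of_one_le_left (f1w_nonneg _)
      (Real.one_le_rpow (by norm_num) (le_max_of_le_left hklt)))
  unfold f1w
  split_ifs with h1 h2 h2
  · exact key hkgt (le_max_right _ _)
  · have hη : 0 < ‖η‖ := by linarith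
    calc ‖ξ‖ ^ kgt ≤ ‖ξ‖ ^ max klt kgt :=
          Real.rpow_le_rpow_of_exponent_le h1.le (le_max_right _ _)
      _ ≤ (2 * ‖η‖) ^ max klt kgt := by
          have : 0 ≤ max klt kgt := le_max_of_le_left hklt
          gcongr
      _ = 2 ^ max klt kgt * ‖η‖ ^ max klt kgt := Real.mul_rpow (by norm_num) hη.le
      _ ≤ _ := by
          gcongr 2 ^ max klt kgt * ?_
          exact Real.rpow_le_rpow_of_exponent_ge hη (not_lt.1 h2) (le_max_left _ _)
  · linarith
  · exact key hklt (le_max_left _ _)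

lemma fgev_le_mul (hν0 : 0 < ν) (hν1 : ν < 1) (hρ : 0 ≤ ρ) {ξ η : EuclideanSpace ℝ (Fin n)}
    (h : ‖η‖ ≤ ‖ξ - η‖) : fgev ν ρ ξ ≤ f0gev ν ρ η ^ ν * fgev ν ρ (ξ - η) := by
  unfold fgev f0gev
  rw [← Real.exp_mul, ← Real.exp_add, Real.exp_le_exp]
  have h1 : ‖ξ‖ ≤ ‖η‖ + ‖ξ - η‖ := by
    simpa [add_comm] using norm_add_le (ξ - η) η
  have h2 := rpow_le_add_of_le_add hν0 hν1 (norm_nonneg η) h (norm_nonneg ξ) h1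
  have h3 : 0 ≤ ν * ‖η‖ ^ ν := by positivity
  have h4 : max (‖ξ‖ ^ ν) 1 ≤ ν * ‖η‖ ^ ν + max (‖ξ - η‖ ^ ν) 1 :=
    max_le (by linarith [le_max_left (‖ξ - η‖ ^ ν) 1]) (by linarith [le_max_right (‖ξ - η‖ ^ ν) 1])
  nlinarith [mul_le_mul_of_nonneg_left h4 hρ]

lemma fbar_le_mul (hν0 : 0 < ν) (hν1 : ν < 1) (hρ : 0 ≤ ρ) (hkgt : 0 ≤ kgt) (hklt : 0 ≤ klt)
    {ξ η : EuclideanSpace ℝ (Fin n)} (h : ‖η‖ ≤ ‖ξ - η‖) :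
    fbar ν ρ kgt klt ξ ≤
      2 ^ max klt kgt * f0gev ν ρ η ^ ν * fbar ν ρ kgt klt (ξ - η) := by
  have h1 : ‖ξ‖ ≤ ‖ξ - η‖ + ‖η‖ := by simpa using norm_add_le (ξ - η) η
  have h2 := mul_le_mul (fgev_le_mul hν0 hν1 hρ h)
    (f1w_le_two_rpow_mul hkgt hklt (show ‖ξ‖ ≤ 2 * ‖ξ - η‖ by linarith)) (f1w_nonneg _)
    (mul_nonneg (Real.rpow_nonneg (Real.exp_pos _).le _) (fgev_pos _).le)
  unfold fbar
  linarith

lemma one_le_f0gev (hρ : 0 ≤ ρ) (η : EuclideanSpace ℝ (Fin n)) : 1 ≤ f0gev ν ρ η :=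
  Real.one_le_exp (by positivity)

lemma fbar_neg (η : EuclideanSpace ℝ (Fin n)) :
    fbar ν ρ kgt klt (-η) = fbar ν ρ kgt klt η := by
  simp [fbar, fgev, f1w]

lemma sq_mul_inv_sq_le {a b s : ℝ} (ha : 0 ≤ a) (hb : 0 ≤ b) (h : a ≤ s * b) :
    a ^ 2 * (b ^ 2)⁻¹ ≤ s ^ 2 := by
  rcases hb.eq_or_lt with rfl | hb
  · simp [sq_nonneg]
  · rw [← div_eq_mul_inv, div_le_iff₀ (by positivity), ← mul_pow]
    gcongr

/-- The squared integration kernel restricted to the half space where `η` is the smaller of the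
two frequencies `η` and `ξ - η`. -/
noncomputable def lowKernel (ν ρ kgt klt : ℝ) (ξ η : EuclideanSpace ℝ (Fin n)) : ℝ :=
  if ‖η‖ ≤ ‖ξ - η‖ then
    fbar ν ρ kgt klt ξ ^ 2 * (fbar ν ρ kgt klt (ξ - η) ^ 2)⁻¹ * (fbar ν ρ kgt klt η ^ 2)⁻¹
  else 0

lemma lowKernel_nonneg (ξ η : EuclideanSpace ℝ (Fin n)) : 0 ≤ lowKernel ν ρ kgt klt ξ η := by
  unfold lowKernel; split_ifs <;> positivity

lemma measurable_lowKernel (ξ : EuclideanSpace ℝ (Fin n)) :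
    Measurable (lowKernel ν ρ kgt klt ξ) := by
  have h := measurable_fbar (n := n) (ν := ν) (ρ := ρ) (kgt := kgt) (klt := klt)
  unfold lowKernel
  exact Measurable.ite (measurableSet_le (by fun_prop) (by fun_prop)) (by fun_prop) (by fun_prop)

lemma lowKernel_le (hν0 : 0 < ν) (hν1 : ν < 1) (hρ : 0 ≤ ρ) (hkgt : 0 ≤ kgt) (hklt : 0 ≤ klt)
    (ξ η : EuclideanSpace ℝ (Fin n)) :
    lowKernel ν ρ kgt klt ξ η ≤
      (fbar ν ρ kgt klt η ^ 2)⁻¹ * (2 ^ (2 * max klt kgt) * f0gev ν ρ η ^ (2 * ν)) := by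
  have h0 : (0 : ℝ) ≤ f0gev ν ρ η := (Real.exp_pos _).le
  unfold lowKernel
  split_ifs with h
  · have := sq_mul_inv_sq_le (fbar_nonneg _) (fbar_nonneg _)
      (fbar_le_mul hν0 hν1 hρ hkgt hklt h)
    rw [mul_comm _ (_ ^ 2)⁻¹]
    refine mul_le_mul_of_nonneg_left (this.trans_eq ?_) (by positivity)
    rw [mul_pow, mul_comm 2 ν, mul_comm 2 (max klt kgt), Real.rpow_mul h0,
      Real.rpow_mul (by norm_num)]
    simp
  · positivity

lemma lowKernel_le_inv (hν : 0 ≤ ν) (hρ : 0 ≤ ρ) (hkgt : 0 ≤ kgt) (hklt : 0 ≤ klt)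
    {ξ η : EuclideanSpace ℝ (Fin n)} (h : ‖ξ‖ ≤ ‖ξ - η‖) :
    lowKernel ν ρ kgt klt ξ η ≤ (fbar ν ρ kgt klt η ^ 2)⁻¹ := by
  unfold lowKernel
  split_ifs
  · have := sq_mul_inv_sq_le (fbar_nonneg _) (fbar_nonneg _)
      ((fbar_mono hν hρ hkgt hklt h).trans_eq (one_mul _).symm)
    refine mul_le_of_le_one_left (by positivity) (by simpa using this)
  · positivity

lemma norm_le_norm_sub_or_norm_le_norm_add {E : Type*} [NormedAddCommGroup E]
    [InnerProductSpace ℝ E] (x y : E) : ‖x‖ ≤ ‖x - y‖ ∨ ‖x‖ ≤ ‖x + y‖ := by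
  by_contra! h
  have := parallelogram_law_with_norm ℝ x y
  nlinarith [norm_nonneg (x - y), norm_nonneg (x + y), norm_nonneg x, norm_nonneg y]

lemma lowKernel_add_neg_le (hν0 : 0 < ν) (hν1 : ν < 1) (hρ : 0 ≤ ρ) (hkgt : 0 ≤ kgt)
    (hklt : 0 ≤ klt) (ξ η : EuclideanSpace ℝ (Fin n)) :
    lowKernel ν ρ kgt klt ξ η + lowKernel ν ρ kgt klt ξ (-η) ≤
      (fbar ν ρ kgt klt η ^ 2)⁻¹ *
        (1 + 2 ^ (2 * max klt kgt) * f0gev ν ρ η ^ (2 * ν)) := by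
  have h1 := lowKernel_le hν0 hν1 hρ hkgt hklt ξ η
  have h2 := lowKernel_le hν0 hν1 hρ hkgt hklt ξ (-η)
  have hf : f0gev ν ρ (-η) = f0gev ν ρ η := by simp [f0gev]
  rw [fbar_neg, hf] at h2
  rw [mul_add, mul_one]
  rcases norm_le_norm_sub_or_norm_le_norm_add ξ η with h | h
  · linarith [lowKernel_le_inv hν0.le hρ hkgt hklt h]
  · have h3 := lowKernel_le_inv (η := -η) hν0.le hρ hkgt hklt (by rwa [sub_neg_eq_add])
    rw [fbar_neg] at h3
    linarith

lemma lintegral_kernel_le (hν0 : 0 < ν) (hν1 : ν < 1) (hρ : 0 ≤ ρ) (hkgt : 0 ≤ kgt)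
    (hklt : 0 ≤ klt) (ξ : EuclideanSpace ℝ (Fin n)) :
    ∫⁻ η, ENNReal.ofReal (fbar ν ρ kgt klt ξ ^ 2 * (fbar ν ρ kgt klt (ξ - η) ^ 2)⁻¹ *
        (fbar ν ρ kgt klt η ^ 2)⁻¹) ≤
      ∫⁻ η : EuclideanSpace ℝ (Fin n), ENNReal.ofReal ((fbar ν ρ kgt klt η ^ 2)⁻¹ *
        (1 + 2 ^ (2 * max klt kgt) * f0gev ν ρ η ^ (2 * ν))) := by
  have hm : Measurable fun η ↦ ENNReal.ofReal (lowKernel ν ρ kgt klt ξ η) :=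
    (measurable_lowKernel ξ).ennreal_ofReal
  calc _ ≤ ∫⁻ η, (ENNReal.ofReal (lowKernel ν ρ kgt klt ξ η) +
          ENNReal.ofReal (lowKernel ν ρ kgt klt ξ (ξ - η))) := by
        refine lintegral_mono fun η ↦ ?_
        rw [← ENNReal.ofReal_add (lowKernel_nonneg _ _) (lowKernel_nonneg _ _)]
        refine ENNReal.ofReal_le_ofReal ?_
        rcases le_total ‖η‖ ‖ξ - η‖ with h | h
        · refine le_add_of_le_of_nonneg ?_ (lowKernel_nonneg _ _)
          rw [lowKernel, if_pos h]
        · refine le_add_of_nonneg_of_le (lowKernel_nonneg _ _) ?_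
          rw [lowKernel, show ξ - (ξ - η) = η by abel, if_pos h, mul_right_comm]
    _ = ∫⁻ η, (ENNReal.ofReal (lowKernel ν ρ kgt klt ξ η) +
          ENNReal.ofReal (lowKernel ν ρ kgt klt ξ (-η))) := by
        rw [lintegral_add_left hm, lintegral_add_left hm,
          lintegral_sub_left_eq_self (fun η ↦ ENNReal.ofReal (lowKernel ν ρ kgt klt ξ η)) ξ,
          lintegral_neg_eq_self (fun η ↦ ENNReal.ofReal (lowKernel ν ρ kgt klt ξ η))]
    _ ≤ _ := by
        refine lintegral_mono fun η ↦ ?_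
        rw [← ENNReal.ofReal_add (lowKernel_nonneg _ _) (lowKernel_nonneg _ _)]
        exact ENNReal.ofReal_le_ofReal (lowKernel_add_neg_le hν0 hν1 hρ hkgt hklt ξ η)

end Weights

section Finiteness

variable {n : ℕ} {ν ρ kgt klt : ℝ}

lemma integrable_norm_rpow_mul_exp_neg_mul_rpow (hn : 1 ≤ n) {s β : ℝ} (hs : -(n : ℝ) < s)
    (hν : 0 < ν) (hβ : 0 < β) :
    Integrable fun η : EuclideanSpace ℝ (Fin n) ↦ ‖η‖ ^ s * Real.exp (-β * ‖η‖ ^ ν) := by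
  have : Nonempty (Fin n) := ⟨⟨0, hn⟩⟩
  refine (integrable_fun_norm_addHaar (volume : Measure (EuclideanSpace ℝ (Fin n)))
    (f := fun x : ℝ ↦ x ^ s * Real.exp (-β * x ^ ν))).2 ?_
  refine (integrableOn_rpow_mul_exp_neg_mul_rpow (s := (n - 1 : ℝ) + s) (by linarith) hν
    hβ).congr_fun (fun x hx ↦ ?_) measurableSet_Ioi
  have hx : 0 < x := hx
  beta_reduce
  rw [finrank_euclideanSpace_fin, smul_eq_mul, Real.rpow_add hx, ← Real.rpow_natCast,
    Nat.cast_sub hn, Nat.cast_one, mul_assoc]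

lemma inv_f1w_sq_le (hkgt : 0 ≤ kgt) (η : EuclideanSpace ℝ (Fin n)) :
    (f1w kgt klt η ^ 2)⁻¹ ≤ 1 + ‖η‖ ^ (-(2 * klt)) := by
  unfold f1w
  split_ifs with h
  · exact (inv_le_one_of_one_le₀ (one_le_pow₀ (Real.one_le_rpow h.le hkgt))).trans
      (le_add_of_nonneg_right (by positivity))
  · rw [Real.rpow_neg (norm_nonneg _), mul_comm 2 klt, Real.rpow_mul (norm_nonneg _)]
    simp

lemma inv_fbar_sq_mul_le (hν : 0 ≤ ν) (hρ : 0 ≤ ρ) (hkgt : 0 ≤ kgt)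
    (η : EuclideanSpace ℝ (Fin n)) {A : ℝ} (hA : 0 ≤ A) :
    (fbar ν ρ kgt klt η ^ 2)⁻¹ * (1 + A * f0gev ν ρ η ^ (2 * ν)) ≤
      (1 + A) * ((1 + ‖η‖ ^ (-(2 * klt))) * Real.exp (-(2 * ρ * (1 - ν)) * ‖η‖ ^ ν)) := by
  have h1 : 1 + A * f0gev ν ρ η ^ (2 * ν) ≤ (1 + A) * f0gev ν ρ η ^ (2 * ν) := by
    linarith [Real.one_le_rpow (one_le_f0gev (ν := ν) hρ η) (by positivity : 0 ≤ 2 * ν)]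
  have h2 : (fgev ν ρ η ^ 2)⁻¹ ≤ (f0gev ν ρ η ^ 2)⁻¹ := by
    have : 0 < f0gev ν ρ η := Real.exp_pos _
    unfold fgev
    unfold f0gev at *
    gcongr
    exact le_max_left _ _
  have h3 : (f0gev ν ρ η ^ 2)⁻¹ * f0gev ν ρ η ^ (2 * ν) =
      Real.exp (-(2 * ρ * (1 - ν)) * ‖η‖ ^ ν) := by
    unfold f0gev
    rw [← Real.exp_mul, ← Real.exp_nat_mul, ← Real.exp_neg, ← Real.exp_add]
    congr 1
    push_cast
    ring
  have h0 : 0 ≤ f0gev ν ρ η := (Real.exp_pos _).le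
  calc _ ≤ ((f0gev ν ρ η ^ 2)⁻¹ * (1 + ‖η‖ ^ (-(2 * klt)))) *
        ((1 + A) * f0gev ν ρ η ^ (2 * ν)) := by
        unfold fbar
        rw [mul_pow, mul_inv]
        have := inv_f1w_sq_le (klt := klt) hkgt η
        gcongr
    _ = _ := by rw [← h3]; ring

lemma lintegral_inv_fbar_sq_mul_lt_top (hn : 1 ≤ n) (hν0 : 0 < ν) (hν1 : ν < 1) (hρ : 0 < ρ)
    (hkgt : 0 ≤ kgt) (hklt : klt < (n : ℝ) / 2) {A : ℝ} (hA : 0 ≤ A) :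
    ∫⁻ η : EuclideanSpace ℝ (Fin n), ENNReal.ofReal
      ((fbar ν ρ kgt klt η ^ 2)⁻¹ * (1 + A * f0gev ν ρ η ^ (2 * ν))) < ⊤ := by
  have hβ : 0 < 2 * ρ * (1 - ν) := mul_pos (by positivity) (by linarith)
  have hn' : (1 : ℝ) ≤ n := by exact_mod_cast hn
  have h1 := integrable_norm_rpow_mul_exp_neg_mul_rpow hn (s := 0) (by linarith) hν0 hβ
  have h2 := integrable_norm_rpow_mul_exp_neg_mul_rpow hn (s := -(2 * klt)) (by linarith) hν0 hβ
  refine (lintegral_mono fun η ↦ ENNReal.ofReal_le_ofReal ?_).trans_lt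
    ((h1.add h2).const_mul (1 + A)).lintegral_lt_top
  refine (inv_fbar_sq_mul_le hν0.le hρ.le hkgt η hA).trans_eq ?_
  simp only [Pi.add_apply, Real.rpow_zero, add_mul]

end Finiteness

section Convolution

variable {n : ℕ}

lemma ENNReal.lintegral_mul_sq_le {α : Type*} [MeasurableSpace α] (μ : Measure α)
    {f g : α → ℝ≥0∞} (hf : AEMeasurable f μ) (hg : AEMeasurable g μ) :
    (∫⁻ a, f a * g a ∂μ) ^ 2 ≤ (∫⁻ a, f a ^ 2 ∂μ) * ∫⁻ a, g a ^ 2 ∂μ := by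
  have h := ENNReal.lintegral_mul_le_Lp_mul_Lq μ Real.HolderConjugate.two_two hf hg
  simp only [Pi.mul_apply, ENNReal.rpow_two] at h
  refine (pow_le_pow_left₀ zero_le h 2).trans_eq ?_
  rw [mul_pow, ← ENNReal.rpow_two, ← ENNReal.rpow_two, ← ENNReal.rpow_mul, ← ENNReal.rpow_mul]
  norm_num

/-- Weighted Cauchy–Schwarz for a convolution, with a weight that vanishes at most at `0`. -/
lemma convAbs_sq_le (hn : 1 ≤ n) {w : EuclideanSpace ℝ (Fin n) → ℝ} (hw : Measurable w)
    (hw0 : ∀ η, η ≠ 0 → 0 < w η) {v₁ v₂ : EuclideanSpace ℝ (Fin n) → ℂ} (h₁ : Measurable v₁)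
    (h₂ : Measurable v₂) (ξ : EuclideanSpace ℝ (Fin n)) :
    convAbs v₁ v₂ ξ ^ 2 ≤
      (∫⁻ η, ENNReal.ofReal ((w (ξ - η) ^ 2)⁻¹ * (w η ^ 2)⁻¹)) *
        ∫⁻ η, (ENNReal.ofReal (w (ξ - η) ^ 2) * (‖v₁ (ξ - η)‖₊ : ℝ≥0∞) ^ 2) *
          (ENNReal.ofReal (w η ^ 2) * (‖v₂ η‖₊ : ℝ≥0∞) ^ 2) := by
  have : Nonempty (Fin n) := ⟨⟨0, hn⟩⟩
  set p : EuclideanSpace ℝ (Fin n) → ℝ≥0∞ := fun η ↦ ENNReal.ofReal (|w (ξ - η)|⁻¹ * |w η|⁻¹)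
  set q : EuclideanSpace ℝ (Fin n) → ℝ≥0∞ := fun η ↦
    (ENNReal.ofReal |w (ξ - η)| * (‖v₁ (ξ - η)‖₊ : ℝ≥0∞)) *
      (ENNReal.ofReal |w η| * (‖v₂ η‖₊ : ℝ≥0∞))
  have hp : Measurable p := by fun_prop
  have hq : Measurable q := by fun_prop
  have hpq : convAbs v₁ v₂ ξ = ∫⁻ η, p η * q η := by
    refine lintegral_congr_ae ?_
    filter_upwards [Measure.ae_ne volume 0, Measure.ae_ne volume ξ] with η hη hξη
    have ha : 0 < |w (ξ - η)| := abs_pos.2 (hw0 _ (sub_ne_zero.2 hξη.symm)).ne'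
    have hb : 0 < |w η| := abs_pos.2 (hw0 _ hη).ne'
    have : ENNReal.ofReal (|w (ξ - η)|⁻¹ * |w η|⁻¹) *
        (ENNReal.ofReal |w (ξ - η)| * ENNReal.ofReal |w η|) = 1 := by
      rw [← ENNReal.ofReal_mul ha.le, ← ENNReal.ofReal_mul (by positivity),
        ← ENNReal.ofReal_one]
      congr 1
      field_simp
    calc _ = 1 * ((‖v₁ (ξ - η)‖₊ : ℝ≥0∞) * (‖v₂ η‖₊ : ℝ≥0∞)) := (one_mul _).symm
      _ = _ := by rw [← this]; simp only [p, q]; ring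
  rw [hpq]
  refine (ENNReal.lintegral_mul_sq_le volume hp.aemeasurable hq.aemeasurable).trans_eq ?_
  congr 1
  · refine lintegral_congr fun η ↦ ?_
    simp only [p]
    rw [← ENNReal.ofReal_pow (by positivity), mul_pow, inv_pow, inv_pow, sq_abs, sq_abs]
  · refine lintegral_congr fun η ↦ ?_
    simp only [q, mul_pow]
    rw [← ENNReal.ofReal_pow (abs_nonneg _), ← ENNReal.ofReal_pow (abs_nonneg _), sq_abs, sq_abs]

lemma lintegral_lintegral_sub_mul {f g : EuclideanSpace ℝ (Fin n) → ℝ≥0∞} (hf : Measurable f)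
    (hg : Measurable g) :
    ∫⁻ ξ, ∫⁻ η, f (ξ - η) * g η = (∫⁻ ξ, f ξ) * ∫⁻ η, g η := by
  rw [lintegral_lintegral_swap (by fun_prop), ← lintegral_const_mul _ hg]
  refine lintegral_congr fun η ↦ ?_
  rw [lintegral_mul_const _ (by fun_prop), lintegral_sub_right_eq_self f η]

end Convolution

/-- Lemma B.1, in convolution form: for `0 < ν < 1`, `ρ > 0`, `k_> ≥ 0`, `0 ≤ k_< < n/2`
and `k = max(k_<, k_>)`, the integral `C² = ∫ f̄(η)⁻² (1 + 2^{2k} f₀(η)^{2ν}) dη` is finite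
and `‖f̄ · (|v₁| ∗ |v₂|)‖₂ ≤ C ‖f̄ v₁‖₂ ‖f̄ v₂‖₂`; i.e. the space `K` with norm
`‖u; K‖ = ‖f̄ û‖₂` is an algebra under pointwise multiplication. -/
theorem stmt19 (n : ℕ) (hn : 1 ≤ n) (ν ρ kgt klt : ℝ)
    (hν0 : 0 < ν) (hν1 : ν < 1) (hρ : 0 < ρ) (hkgt : 0 ≤ kgt)
    (hklt0 : 0 ≤ klt) (hkltn : klt < (n : ℝ) / 2) :
    (∫⁻ η : EuclideanSpace ℝ (Fin n),
        ENNReal.ofReal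
          ((fbar ν ρ kgt klt η ^ 2)⁻¹ *
            (1 + 2 ^ (2 * max klt kgt) * f0gev ν ρ η ^ (2 * ν)))) < ⊤ ∧
    ∀ v₁ v₂ : EuclideanSpace ℝ (Fin n) → ℂ, Measurable v₁ → Measurable v₂ →
      (∫⁻ ξ, ENNReal.ofReal (fbar ν ρ kgt klt ξ ^ 2) * convAbs v₁ v₂ ξ ^ 2) ^ ((1 : ℝ) / 2) ≤
        (∫⁻ η : EuclideanSpace ℝ (Fin n),
            ENNReal.ofReal
              ((fbar ν ρ kgt klt η ^ 2)⁻¹ *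
                (1 + 2 ^ (2 * max klt kgt) * f0gev ν ρ η ^ (2 * ν)))) ^ ((1 : ℝ) / 2) *
          (∫⁻ ξ, ENNReal.ofReal (fbar ν ρ kgt klt ξ ^ 2) *
              (‖v₁ ξ‖₊ : ℝ≥0∞) ^ 2) ^ ((1 : ℝ) / 2) *
          (∫⁻ ξ, ENNReal.ofReal (fbar ν ρ kgt klt ξ ^ 2) *
              (‖v₂ ξ‖₊ : ℝ≥0∞) ^ 2) ^ ((1 : ℝ) / 2) := by
  refine ⟨lintegral_inv_fbar_sq_mul_lt_top hn hν0 hν1 hρ hkgt hkltn (by positivity),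
    fun v₁ v₂ h₁ h₂ ↦ ?_⟩
  have hw := measurable_fbar (n := n) (ν := ν) (ρ := ρ) (kgt := kgt) (klt := klt)
  rw [← ENNReal.mul_rpow_of_nonneg _ _ (by norm_num), ← ENNReal.mul_rpow_of_nonneg _ _ (by norm_num),
    mul_assoc, ← lintegral_lintegral_sub_mul (by fun_prop) (by fun_prop)]
  refine ENNReal.rpow_le_rpow ?_ (by norm_num)
  rw [← lintegral_const_mul _ (Measurable.lintegral_prod_right' (f := fun z :
    EuclideanSpace ℝ (Fin n) × EuclideanSpace ℝ (Fin n) ↦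
      ENNReal.ofReal (fbar ν ρ kgt klt (z.1 - z.2) ^ 2) * (‖v₁ (z.1 - z.2)‖₊ : ℝ≥0∞) ^ 2 *
        (ENNReal.ofReal (fbar ν ρ kgt klt z.2 ^ 2) * (‖v₂ z.2‖₊ : ℝ≥0∞) ^ 2)) (by fun_prop))]
  refine lintegral_mono fun ξ ↦ ?_
  refine (mul_le_mul_right (convAbs_sq_le hn hw (fun η ↦ fbar_pos) h₁ h₂ ξ) _).trans ?_
  rw [← mul_assoc]
  refine mul_le_mul_left (Eq.trans_le ?_
    (lintegral_kernel_le hν0 hν1 hρ.le hkgt hklt0 ξ)) _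
  rw [← lintegral_const_mul _ (by fun_prop)]
  refine lintegral_congr fun η ↦ ?_
  rw [← ENNReal.ofReal_mul (by positivity), mul_assoc]
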